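/- Suppose W, Z ⊆ ℕ satisfy W ≰_T Z, and g : ℕ → Fin n is an arbitrary finite partition of ℕ (with no computability hypothesis on g). Then there exist k < n and an infinite set X ⊆ g⁻¹(k) such that W ≰_T Z ⊕ X. -/

import Mathlib

namespace RRT

/-- Partial functions on ℕ that are recursive in the oracle `O`.
This mirrors `Nat.Partrec`, with an extra constructor for the oracle. -/
inductive RecursiveIn (O : ℕ →. ℕ) : (ℕ →. ℕ) → Prop
  | zero : RecursiveIn O (pure 0)
  | succ : RecursiveIn O Nat.succ
  | left : RecursiveIn O ↑fun n : ℕ => n.unpair.1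
  | right : RecursiveIn O ↑fun n : ℕ => n.unpair.2
  | oracle : RecursiveIn O O
  | pair {f g} : RecursiveIn O f → RecursiveIn O g →
      RecursiveIn O fun n => Nat.pair <$> f n <*> g n
  | comp {f g} : RecursiveIn O f → RecursiveIn O g →
      RecursiveIn O fun n => g n >>= f
  | prec {f g} : RecursiveIn O f → RecursiveIn O g →
      RecursiveIn O (Nat.unpaired fun a n =>
        n.rec (f a) fun y IH => do let i ← IH; g (Nat.pair a (Nat.pair y i)))
  | rfind {f} : RecursiveIn O f →
      RecursiveIn O fun a => Nat.rfind fun n => (fun m => m = 0) <$> f (Nat.pair a n)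

/-- The characteristic function of a set of naturals. -/
noncomputable def chi (A : Set ℕ) : ℕ → ℕ := A.indicator fun _ => 1

/-- Turing reducibility `A ≤_T B` for sets of naturals: the characteristic function of `A`
is computable relative to an oracle for the characteristic function of `B`. -/
def TuringLE (A B : Set ℕ) : Prop := RecursiveIn (chi B) (chi A)

/-- The recursive join `A ⊕ B = {2n : n ∈ A} ∪ {2n+1 : n ∈ B}`. -/
def join (A B : Set ℕ) : Set ℕ :=
  {n : ℕ | (∃ m ∈ A, n = 2 * m) ∨ (∃ m ∈ B, n = 2 * m + 1)}

/-- A total function `f : ℕ → ℕ` is computable relative to an oracle for `Z ⊆ ℕ`. -/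
def FunRecIn (Z : Set ℕ) (f : ℕ → ℕ) : Prop := RecursiveIn (chi Z) f


/-! ### Strings, primitive recursive predicates, relative enumerability -/

def pre (Y : ℕ → ℕ) (m : ℕ) : List ℕ := (List.range m).map Y

def tens (Y H : ℕ → ℕ) : ℕ → ℕ := fun i => Nat.pair (Y i) (H i)

def RE (Y : ℕ → ℕ) (R : ℕ → ℕ → Prop) : Prop :=
  ∃ Q : List ℕ × ℕ × ℕ → Prop, PrimrecPred Q ∧ ∀ x b, R x b ↔ ∃ m, Q (pre Y m, x, b)

def Good (w : ℕ → ℕ) (Y : ℕ → ℕ) : Prop := ¬ RE Y (fun x b => w x = b)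

theorem pre_length (Y : ℕ → ℕ) (m : ℕ) : (pre Y m).length = m := by simp [pre]

theorem pre_getD (Y : ℕ → ℕ) (m i : ℕ) (h : i < m) : (pre Y m).getD i 0 = Y i := by
  simp [pre, List.getD, h]

theorem pre_congr {Y Y' : ℕ → ℕ} {m : ℕ} (h : ∀ i < m, Y i = Y' i) : pre Y m = pre Y' m := by
  unfold pre
  apply List.map_congr_left
  intro i hi
  exact h i (by simpa using hi)

section prim
variable {α β : Type*} [Primcodable α] [Primcodable β]

theorem pp_ex {f : α → List β} {R : α → β → Prop} (hf : Primrec f)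
    (hR : PrimrecPred fun p : α × β => R p.1 p.2) :
    PrimrecPred fun a => ∃ b ∈ f a, R a b := by
  have h1 : PrimrecRel (fun (b : β) (a : α) => R a b) :=
    hR.comp (Primrec.snd.pair Primrec.fst)
  exact (h1.exists_mem_list).comp hf Primrec.id

theorem pp_all {f : α → List β} {R : α → β → Prop} (hf : Primrec f)
    (hR : PrimrecPred fun p : α × β => R p.1 p.2) :
    PrimrecPred fun a => ∀ b ∈ f a, R a b := by
  have h1 : PrimrecRel (fun (b : β) (a : α) => R a b) :=
    hR.comp (Primrec.snd.pair Primrec.fst)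
  exact (h1.forall_mem_list).comp hf Primrec.id

theorem pp_const (p : Prop) : PrimrecPred fun _ : α => p := by
  by_cases h : p
  · exact (Primrec.eq.comp (Primrec.const 0) (Primrec.const 0)).of_eq (by simp [h])
  · exact (Primrec.eq.comp (Primrec.const 0) (Primrec.const 1)).of_eq (by simp [h])

theorem pp_fin {n : ℕ} {R : Fin n → α → Prop} (hR : ∀ k, PrimrecPred (R k)) :
    PrimrecPred fun a => ∃ k, R k a := by
  induction n with
  | zero => exact (pp_const False).of_eq (by simp)
  | succ n ih =>
    exact ((hR 0).or (ih (fun k => hR k.succ))).of_eq (fun a => by rw [Fin.exists_fin_succ])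

theorem pp_finset (F : Finset ℕ) : PrimrecPred fun i : ℕ => i ∈ F :=
  (pp_ex (f := fun _ : ℕ => F.toList) (R := fun a b => a = b) (Primrec.const _)
    (Primrec.eq.comp Primrec.fst Primrec.snd)).of_eq (by simp)

end prim

def allStr (n : ℕ) (N : ℕ) : List (List ℕ) :=
  Nat.rec [[]] (fun _ L => L.flatMap fun τ => (List.range n).map fun a => τ ++ [a]) N

theorem allStr_succ (n N : ℕ) : allStr n (N+1) =
    (allStr n N).flatMap fun τ => (List.range n).map fun a => τ ++ [a] := rfl

theorem allStr_prim (n : ℕ) : Primrec (allStr n) := by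
  refine Primrec.nat_rec₁ (f := fun _ L =>
    List.flatMap (fun τ => (List.range n).map fun a => τ ++ [a]) L) _ ?_
  refine Primrec.list_flatMap Primrec.snd ?_
  refine Primrec.list_map (Primrec.const _) ?_
  exact Primrec.list_concat.comp (Primrec.snd.comp Primrec.fst) Primrec.snd

theorem mem_allStr (n N : ℕ) (f : ℕ → ℕ) (hf : ∀ i < N, f i < n) : pre f N ∈ allStr n N := by
  induction N with
  | zero => simp [pre, allStr]
  | succ N ih =>
    rw [allStr_succ, List.mem_flatMap]
    refine ⟨pre f N, ih (fun i hi => hf i (by omega)), ?_⟩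
    simp [pre, List.range_succ]
    exact hf N (by omega)

theorem lt_of_mem_allStr (n N : ℕ) (τ : List ℕ) (h : τ ∈ allStr n N) :
    τ.length = N ∧ ∀ a ∈ τ, a < n := by
  induction N generalizing τ with
  | zero => simp [allStr] at h; simp [h]
  | succ N ih =>
    rw [allStr_succ, List.mem_flatMap] at h
    obtain ⟨ρ, h1, h2⟩ := h
    simp at h2
    obtain ⟨a, ha, rfl⟩ := h2
    obtain ⟨h3, h4⟩ := ih ρ h1
    refine ⟨by simp [h3], ?_⟩
    intro c hc
    simp at hc
    rcases hc with hc | rfl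
    · exact h4 c hc
    · exact ha

/-- Transform strings entrywise (with access to the full string). -/
theorem RE_transform {Y Y' : ℕ → ℕ} {R : ℕ → ℕ → Prop} (f : ℕ → List ℕ → ℕ) (hf : Primrec₂ f)
    (h : ∀ m, ∀ i < m, f i (pre Y m) = Y' i) (hR : RE Y' R) : RE Y R := by
  obtain ⟨Q, hQ, hQR⟩ := hR
  refine ⟨fun p => Q ((List.range p.1.length).map (fun i => f i p.1), p.2.1, p.2.2), ?_, ?_⟩
  · refine hQ.comp (Primrec.pair ?_ Primrec.snd)
    refine Primrec.list_map (Primrec.list_range.comp (Primrec.list_length.comp Primrec.fst)) ?_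
    exact hf.comp Primrec.snd (Primrec.fst.comp Primrec.fst)
  · intro x b
    rw [hQR]
    refine exists_congr fun m => ?_
    have : (List.range (pre Y m).length).map (fun i => f i (pre Y m)) = pre Y' m := by
      rw [pre_length]
      unfold pre
      apply List.map_congr_left
      intro i hi
      exact h m i (by simpa using hi)
    simp only [this]

theorem Good_transform {w Y Y' : ℕ → ℕ} (f : ℕ → List ℕ → ℕ) (hf : Primrec₂ f)
    (h : ∀ m, ∀ i < m, f i (pre Y m) = Y' i) (hR : Good w Y) : Good w Y' :=
  fun h' => hR (RE_transform f hf h h')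

/-- pointwise version -/
theorem Good_map {w Y Y' : ℕ → ℕ} (f : ℕ → ℕ → ℕ) (hf : Primrec₂ f)
    (h : ∀ i, f i (Y i) = Y' i) (hR : Good w Y) : Good w Y' := by
  refine Good_transform (fun i σ => f i (σ.getD i 0)) ?_ ?_ hR
  · exact hf.comp Primrec.fst ((Primrec.list_getD 0).comp Primrec.snd Primrec.fst)
  · intro m i hi
    simp only [pre_getD Y m i hi, h]

def hv {n : ℕ} (h : ℕ → Fin (n+1)) : ℕ → ℕ := fun i => (h i : ℕ)

theorem isOpen_pre {n : ℕ} (Y : ℕ → ℕ) (m : ℕ) (p : List ℕ → Prop) :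
    IsOpen {h : ℕ → Fin (n+1) | p (pre (tens Y (hv h)) m)} := by
  rw [isOpen_iff_forall_mem_open]
  intro h hh
  refine ⟨{h' | ∀ i ∈ Finset.range m, h' i = h i}, ?_, ?_, ?_⟩
  · intro h' hh'
    have : pre (tens Y (hv h')) m = pre (tens Y (hv h)) m := by
      apply pre_congr
      intro i hi
      have := hh' i (by simpa using hi)
      simp [tens, hv, this]
    simpa [this] using hh
  · have : {h' : ℕ → Fin (n+1) | ∀ i ∈ Finset.range m, h' i = h i} =
      ⋂ i ∈ Finset.range m, (fun h' : ℕ → Fin (n+1) => h' i) ⁻¹' {h i} := by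
        ext; simp
    rw [this]
    exact isOpen_biInter_finset fun i _ => (isOpen_discrete _).preimage (continuous_apply i)
  · intro i _; rfl

theorem RE_compact {n : ℕ} (Y : ℕ → ℕ) (P : List ℕ × ℕ × ℕ → Prop) (hP : PrimrecPred P) :
    RE Y (fun x b => ∀ h : ℕ → Fin (n+1), ∃ m, P (pre (tens Y (hv h)) m, x, b)) := by
  refine ⟨fun p => ∀ τ ∈ allStr (n+1) p.1.length, ∃ m ∈ List.range (p.1.length + 1),
    P ((List.range m).map (fun i => Nat.pair (p.1.getD i 0) (τ.getD i 0)), p.2.1, p.2.2), ?_, ?_⟩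
  · refine pp_all ((allStr_prim _).comp (Primrec.list_length.comp Primrec.fst)) ?_
    refine pp_ex (Primrec.list_range.comp (Primrec.succ.comp
      (Primrec.list_length.comp (Primrec.fst.comp Primrec.fst)))) ?_
    refine hP.comp (Primrec.pair ?_ (Primrec.snd.comp (Primrec.fst.comp Primrec.fst)))
    refine Primrec.list_map (Primrec.list_range.comp Primrec.snd) ?_
    refine Primrec₂.natPair.comp ?_ ?_
    · exact (Primrec.list_getD 0).comp (Primrec.fst.comp (Primrec.fst.comp
        (Primrec.fst.comp Primrec.fst))) Primrec.snd
    · exact (Primrec.list_getD 0).comp (Primrec.snd.comp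
        (Primrec.fst.comp Primrec.fst)) Primrec.snd
  · intro x b
    constructor
    · intro H
      have hcov : (Set.univ : Set (ℕ → Fin (n+1))) ⊆
          ⋃ m, {h : ℕ → Fin (n+1) | P (pre (tens Y (hv h)) m, x, b)} := by
        intro h _
        simpa using H h
      obtain ⟨t, ht⟩ := isCompact_univ.elim_finite_subcover _
        (fun m => isOpen_pre Y m (fun σ => P (σ, x, b))) hcov
      refine ⟨t.sup id, ?_⟩
      intro τ hτ
      simp only [pre_length] at hτ ⊢
      obtain ⟨h1, h2⟩ := lt_of_mem_allStr _ _ _ hτ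
      have := ht (Set.mem_univ (fun i => Fin.ofNat (n+1) (τ.getD i 0)))
      simp only [Set.mem_iUnion, Set.mem_ofPred_eq] at this
      obtain ⟨m, hm, hPm⟩ := this
      have hmN : m ≤ t.sup id := Finset.le_sup (f := id) hm
      refine ⟨m, by simp; omega, ?_⟩
      convert hPm using 2
      unfold pre
      apply List.map_congr_left
      intro i hi
      have him : i < m := by simpa using hi
      have h3 : i < τ.length := by omega
      have h4 := pre_getD Y (t.sup id) i (by omega)
      unfold pre at h4
      rw [h4]
      simp only [tens, hv, Fin.val_ofNat]
      rw [Nat.mod_eq_of_lt]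
      rw [List.getD_eq_getElem _ _ h3]
      exact h2 _ (List.getElem_mem _)
    · rintro ⟨N, hN⟩ h
      obtain ⟨m, hm, hPm⟩ := hN (pre (hv h) N)
        (by rw [pre_length]; exact mem_allStr _ _ _ (fun i _ => (h i).2))
      refine ⟨m, ?_⟩
      convert hPm using 2
      unfold pre
      apply List.map_congr_left
      intro i hi
      have h1 : i < m := by simpa using hi
      have h2 : m < N + 1 := by simpa [pre_length] using hm
      have h4 := pre_getD Y N i (by omega)
      have h5 := pre_getD (hv h) N i (by omega)
      unfold pre at h4 h5
      rw [h4, h5, tens]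

theorem dichotomy {n : ℕ} {w Y : ℕ → ℕ} (hY : Good w Y) (P : List ℕ × ℕ × ℕ → Prop)
    (hP : PrimrecPred P) :
    (∃ x b, b ≠ w x ∧ ∀ h : ℕ → Fin (n+1), ∃ m, P (pre (tens Y (hv h)) m, x, b)) ∨
    (∃ x, ∃ h : ℕ → Fin (n+1), ∀ m, ¬ P (pre (tens Y (hv h)) m, x, w x)) := by
  by_contra hcon
  push Not at hcon
  obtain ⟨h1, h2⟩ := hcon
  apply hY
  obtain ⟨Q, hQ, hQR⟩ := RE_compact (n := n) Y P hP
  refine ⟨Q, hQ, fun x b => ?_⟩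
  rw [← hQR]
  constructor
  · rintro rfl
    exact h2 x
  · intro h
    by_contra hne
    obtain ⟨h', hh'⟩ := h1 x b (Ne.symm hne)
    obtain ⟨m, hm⟩ := h h'
    exact hh' m hm

theorem countable_pp {α : Type*} [Primcodable α] : {Q : α → Prop | PrimrecPred Q}.Countable := by
  classical
  have key : ∀ Q : α → Prop, PrimrecPred Q → ∃ c : Nat.Partrec.Code, ∀ a,
      (Q a ↔ Encodable.encode true ∈ c.eval (Encodable.encode a)) := by
    intro Q hQ
    have h1 : Partrec (fun a => (decide (Q a) : Part Bool)) := hQ.decide.to_comp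
    obtain ⟨c, hc⟩ := Nat.Partrec.Code.exists_code.1 h1
    refine ⟨c, fun a => ?_⟩
    rw [hc]
    by_cases hq : Q a <;> simp [hq]
  rw [Set.countable_iff_exists_injective]
  choose c hc using key
  refine ⟨fun Q => Encodable.encode (c Q.1 Q.2), ?_⟩
  intro Q Q' h
  have h' := Encodable.encode_injective h
  apply Subtype.ext
  funext a
  apply propext
  rw [hc Q.1 Q.2, hc Q'.1 Q'.2, h']

/-- Cone avoidance basis theorem -/
theorem basis {n : ℕ} {w Y : ℕ → ℕ} (hY : Good w Y) (B : List ℕ → Prop) (hB : PrimrecPred B)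
    (hne : ∃ h : ℕ → Fin (n+1), ∀ m, ¬ B (pre (tens Y (hv h)) m)) :
    ∃ h : ℕ → Fin (n+1), (∀ m, ¬ B (pre (tens Y (hv h)) m)) ∧ Good w (tens Y (hv h)) := by
  classical
  let T := {B : List ℕ → Prop // PrimrecPred B ∧
    ∃ h : ℕ → Fin (n+1), ∀ m, ¬ B (pre (tens Y (hv h)) m)}
  let C : T → Set (ℕ → Fin (n+1)) := fun B => {h | ∀ m, ¬ B.1 (pre (tens Y (hv h)) m)}
  obtain ⟨e, he⟩ := (countable_pp (α := List ℕ × ℕ × ℕ)).exists_eq_range ⟨_, pp_const True⟩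
  have hee : ∀ i, PrimrecPred (e i) := fun i => by
    have : e i ∈ Set.range e := ⟨i, rfl⟩
    rwa [← he] at this
  have step : ∀ (i : ℕ) (B : T), ∃ B' : T, C B' ⊆ C B ∧ ∀ h ∈ C B',
      ¬ ∀ x b, w x = b ↔ ∃ m, e i (pre (tens Y (hv h)) m, x, b) := by
    rintro i ⟨B, hB, hBne⟩
    rcases dichotomy (n := n) hY (fun p => B p.1 ∨ e i p) ((hB.comp Primrec.fst).or (hee i)) with
      ⟨x, b, hb, H⟩ | ⟨x, h, H⟩
    · refine ⟨⟨B, hB, hBne⟩, subset_rfl, ?_⟩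
      intro h hh hcon
      obtain ⟨m, hm⟩ := H h
      exact hb ((hcon x b).2 ⟨m, hm.resolve_left (hh m)⟩).symm
    · refine ⟨⟨fun σ => B σ ∨ e i (σ, x, w x), ?_, h, H⟩, ?_, ?_⟩
      · exact hB.or ((hee i).comp (Primrec.id.pair (Primrec.const _)))
      · intro h' hh' m hm
        exact hh' m (Or.inl hm)
      · intro h' hh' hcon
        obtain ⟨m, hm⟩ := (hcon x (w x)).1 rfl
        exact hh' m (Or.inr hm)
  choose s hs1 hs2 using step
  let D : ℕ → T := fun i => Nat.rec ⟨B, hB, hne⟩ (fun i B => s i B) i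
  have hD : ∀ i, D (i+1) = s i (D i) := fun i => rfl
  obtain ⟨h, hh⟩ := IsCompact.nonempty_iInter_of_sequence_nonempty_isCompact_isClosed
    (fun i => C (D i)) (fun i => by rw [hD]; exact hs1 i _) (fun i => (D i).2.2) 
    (by
      apply IsClosed.isCompact
      have : C (D 0) = ⋂ m, {h | ¬ (D 0).1 (pre (tens Y (hv h)) m)} := by
        ext; simp [C]
      rw [this]
      exact isClosed_iInter fun m => (isOpen_pre Y m _).isClosed_compl)
    (fun i => by
      have : C (D i) = ⋂ m, {h | ¬ (D i).1 (pre (tens Y (hv h)) m)} := by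
        ext; simp [C]
      rw [this]
      exact isClosed_iInter fun m => (isOpen_pre Y m _).isClosed_compl)
  rw [Set.mem_iInter] at hh
  refine ⟨h, hh 0, ?_⟩
  rintro ⟨Q, hQ, hQR⟩
  have hQ' : Q ∈ Set.range e := by rw [← he]; exact hQ
  obtain ⟨i, rfl⟩ := hQ'
  exact hs2 i (D i) h (hh (i+1)) hQR

/-! ### The forcing construction -/

theorem chi_eq_one {A : Set ℕ} {i : ℕ} : chi A i = 1 ↔ i ∈ A := by
  by_cases h : i ∈ A <;> simp [chi, h]

theorem chi_of_mem {A : Set ℕ} {i : ℕ} (h : i ∈ A) : chi A i = 1 := chi_eq_one.2 h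

theorem chi_of_not_mem {A : Set ℕ} {i : ℕ} (h : i ∉ A) : chi A i = 0 := by simp [chi, h]

theorem chi_congr {A B : Set ℕ} {i : ℕ} (h : i ∈ A ↔ i ∈ B) : chi A i = chi B i := by
  by_cases h' : i ∈ B
  · rw [chi_of_mem h', chi_of_mem (h.2 h')]
  · rw [chi_of_not_mem h', chi_of_not_mem (fun hh => h' (h.1 hh))]

theorem chi_lt_two (A : Set ℕ) (i : ℕ) : chi A i < 2 := by
  by_cases h : i ∈ A
  · rw [chi_of_mem h]; omega
  · rw [chi_of_not_mem h]; omega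

/-- The set of pairs (oracle for `Z`, oracle for `X`). -/
noncomputable def zx (Z X : Set ℕ) : ℕ → ℕ := tens (chi Z) (chi X)

theorem good_inter_ge {w : ℕ → ℕ} {Z X : Set ℕ} (h : Good w (zx Z X)) (s : ℕ) :
    Good w (zx Z (X ∩ {i | s ≤ i})) := by
  refine Good_map (fun i y => if s ≤ i then y else Nat.pair y.unpair.1 0) ?_ ?_ h
  · refine Primrec.ite (Primrec.nat_le.comp (Primrec.const s) Primrec.fst) Primrec.snd ?_
    exact Primrec₂.natPair.comp (Primrec.fst.comp (Primrec.unpair.comp Primrec.snd))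
      (Primrec.const 0)
  · intro i
    by_cases hi : s ≤ i
    · simp only [hi, if_true, zx, tens]
      rw [chi_congr (A := X) (B := X ∩ {i | s ≤ i}) (by simp [hi])]
    · simp only [hi, if_false, zx, tens, Nat.unpair_pair]
      rw [chi_of_not_mem (A := X ∩ {i | s ≤ i}) (by simp [hi])]

theorem good_inter_color {n : ℕ} {w : ℕ → ℕ} {Z X : Set ℕ} {h : ℕ → Fin (n+1)} (k : Fin (n+1))
    (hg : Good w (tens (zx Z X) (hv h))) :
    Good w (zx Z (X ∩ h ⁻¹' {k})) := by
  refine Good_map (fun _ y => if y.unpair.2 = (k : ℕ) then y.unpair.1 else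
    Nat.pair y.unpair.1.unpair.1 0) ?_ ?_ hg
  · refine Primrec.ite (Primrec.eq.comp (Primrec.snd.comp (Primrec.unpair.comp Primrec.snd))
      (Primrec.const _)) (Primrec.fst.comp (Primrec.unpair.comp Primrec.snd)) ?_
    exact Primrec₂.natPair.comp (Primrec.fst.comp (Primrec.unpair.comp
      (Primrec.fst.comp (Primrec.unpair.comp Primrec.snd))))
      (Primrec.const 0)
  · intro i
    by_cases hi : h i = k
    · simp only [hi, zx, tens, hv, Nat.unpair_pair, if_true]
      rw [chi_congr (A := X) (B := X ∩ h ⁻¹' {k}) (by simp [hi])]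
    · have : ¬ ((h i : ℕ) = k) := fun h' => hi (Fin.ext h')
      simp only [this, if_false, zx, tens, Nat.unpair_pair, hv]
      rw [chi_of_not_mem (A := X ∩ h ⁻¹' {k}) (by simp [hi])]

/-- `Q` does not compute `w` from `Z ⊕ G`. -/
def Fails (w : ℕ → ℕ) (Z G : Set ℕ) (Q : List ℕ × ℕ × ℕ → Prop) : Prop :=
  ¬ ∀ x b, w x = b ↔ ∃ m, Q (pre (zx Z G) m, x, b)

/-- The predicate on strings used in the forcing question. -/
def quest {n : ℕ} (F : Fin (n+1) → Finset ℕ) (Q : Fin (n+1) → List ℕ × ℕ × ℕ → Prop)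
    (p : List ℕ × ℕ × ℕ) : Prop :=
  ∃ k : Fin (n+1), ∃ ρ ∈ allStr 2 p.1.length,
    (∀ i ∈ List.range p.1.length, ρ.getD i 0 = 1 →
      (p.1.getD i 0).unpair.1.unpair.2 = 1 ∧ (p.1.getD i 0).unpair.2 = (k : ℕ)) ∧
    Q k ((List.range p.1.length).map (fun i => Nat.pair (p.1.getD i 0).unpair.1.unpair.1
      (if i ∈ F k ∨ ρ.getD i 0 = 1 then 1 else 0)), p.2.1, p.2.2)

theorem getD_prim1 : Primrec (fun p : ((List ℕ × ℕ × ℕ) × List ℕ) × ℕ => p.1.1.1.getD p.2 0) :=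
  (Primrec.list_getD 0).comp (Primrec.fst.comp (Primrec.fst.comp Primrec.fst)) Primrec.snd

theorem getD_prim2 : Primrec (fun p : ((List ℕ × ℕ × ℕ) × List ℕ) × ℕ => p.1.2.getD p.2 0) :=
  (Primrec.list_getD 0).comp (Primrec.snd.comp Primrec.fst) Primrec.snd

theorem quest_prim1 (k : ℕ) : PrimrecPred (fun p : ((List ℕ × ℕ × ℕ) × List ℕ) × ℕ =>
    p.1.2.getD p.2 0 = 1 →
      (p.1.1.1.getD p.2 0).unpair.1.unpair.2 = 1 ∧ (p.1.1.1.getD p.2 0).unpair.2 = k) := by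
  have f1 : PrimrecPred (fun p : ((List ℕ × ℕ × ℕ) × List ℕ) × ℕ => p.1.2.getD p.2 0 = 1) :=
    Primrec.eq.comp getD_prim2 (Primrec.const 1)
  have f2 : PrimrecPred (fun p : ((List ℕ × ℕ × ℕ) × List ℕ) × ℕ =>
      (p.1.1.1.getD p.2 0).unpair.1.unpair.2 = 1) :=
    Primrec.eq.comp (Primrec.snd.comp (Primrec.unpair.comp (Primrec.fst.comp
      (Primrec.unpair.comp getD_prim1)))) (Primrec.const 1)
  have f3 : PrimrecPred (fun p : ((List ℕ × ℕ × ℕ) × List ℕ) × ℕ =>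
      (p.1.1.1.getD p.2 0).unpair.2 = k) :=
    Primrec.eq.comp (Primrec.snd.comp (Primrec.unpair.comp getD_prim1)) (Primrec.const k)
  refine (f1.not.or (f2.and f3)).of_eq (fun p => ?_)
  rw [imp_iff_not_or]

theorem quest_prim2 (S : Finset ℕ) : Primrec (fun p : ((List ℕ × ℕ × ℕ) × List ℕ) × ℕ =>
    Nat.pair (p.1.1.1.getD p.2 0).unpair.1.unpair.1
      (if p.2 ∈ S ∨ p.1.2.getD p.2 0 = 1 then 1 else 0)) := by
  refine Primrec₂.natPair.comp ?_ ?_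
  · exact (Primrec.fst.comp (Primrec.unpair.comp (Primrec.fst.comp
      (Primrec.unpair.comp getD_prim1))))
  · refine Primrec.ite ?_ (Primrec.const 1) (Primrec.const 0)
    exact ((pp_finset S).comp Primrec.snd).or (Primrec.eq.comp getD_prim2 (Primrec.const 1))

theorem quest_prim {n : ℕ} (F : Fin (n+1) → Finset ℕ) (Q : Fin (n+1) → List ℕ × ℕ × ℕ → Prop)
    (hQ : ∀ k, PrimrecPred (Q k)) : PrimrecPred (quest F Q) := by
  refine pp_fin fun k => ?_
  refine pp_ex ((allStr_prim 2).comp (Primrec.list_length.comp Primrec.fst)) ?_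
  refine PrimrecPred.and ?_ ?_
  · exact pp_all (Primrec.list_range.comp (Primrec.list_length.comp
      (Primrec.fst.comp Primrec.fst))) (quest_prim1 k)
  · refine (hQ k).comp (Primrec.pair ?_ (Primrec.snd.comp Primrec.fst))
    exact Primrec.list_map (Primrec.list_range.comp (Primrec.list_length.comp
      (Primrec.fst.comp Primrec.fst))) (quest_prim2 (F k))

theorem quest_iff {n : ℕ} (F : Fin (n+1) → Finset ℕ) (Q : Fin (n+1) → List ℕ × ℕ × ℕ → Prop)
    (Z X : Set ℕ) (h : ℕ → Fin (n+1)) (m x b : ℕ) :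
    quest F Q (pre (tens (zx Z X) (hv h)) m, x, b) ↔
    ∃ k, ∃ E : Set ℕ, (∀ i ∈ E, i < m ∧ i ∈ X ∧ h i = k) ∧
      Q k (pre (zx Z (F k ∪ E)) m, x, b) := by
  have ent : ∀ i < m, (pre (tens (zx Z X) (hv h)) m).getD i 0 =
      Nat.pair (Nat.pair (chi Z i) (chi X i)) (h i) := by
    intro i hi
    rw [pre_getD _ _ _ hi]
    rfl
  unfold quest
  simp only [pre_length]
  refine exists_congr fun k => ?_
  constructor
  · rintro ⟨ρ, hρ, h1, h2⟩
    refine ⟨{i | i < m ∧ ρ.getD i 0 = 1}, ?_, ?_⟩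
    · rintro i ⟨hi, hi1⟩
      have := h1 i (by simpa using hi) hi1
      rw [ent i hi] at this
      simp only [Nat.unpair_pair] at this
      exact ⟨hi, chi_eq_one.1 this.1, Fin.ext this.2⟩
    · convert h2 using 2
      unfold pre
      apply List.map_congr_left
      intro i hi
      have him : i < m := by simpa using hi
      have e := ent i him
      unfold pre at e
      rw [e]
      simp only [Nat.unpair_pair, zx, tens]
      congr 1
      by_cases hc : i ∈ F k ∨ ρ.getD i 0 = 1
      · rw [if_pos hc]
        refine chi_of_mem ?_
        rcases hc with hc | hc
        · exact Or.inl hc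
        · exact Or.inr ⟨him, hc⟩
      · rw [if_neg hc]
        refine chi_of_not_mem ?_
        rintro (h' | h')
        · exact hc (Or.inl h')
        · exact hc (Or.inr h'.2)
  · rintro ⟨E, hE, hQE⟩
    refine ⟨pre (chi E) m, mem_allStr _ _ _ (fun i _ => chi_lt_two E i), ?_, ?_⟩
    · intro i hi hi1
      have him : i < m := by simpa using hi
      rw [pre_getD _ _ _ him] at hi1
      obtain ⟨-, h2, h3⟩ := hE i (chi_eq_one.1 hi1)
      rw [ent i him]
      simp only [Nat.unpair_pair]
      exact ⟨chi_of_mem h2, by rw [h3]⟩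
    · convert hQE using 2
      unfold pre
      apply List.map_congr_left
      intro i hi
      have him : i < m := by simpa using hi
      have e := ent i him
      have e' := pre_getD (chi E) _ _ him
      unfold pre at e e'
      rw [e, e']
      simp only [Nat.unpair_pair, zx, tens, chi_eq_one]
      congr 1
      by_cases hc : i ∈ F k ∨ chi E i = 1
      · rw [if_pos hc, chi_of_mem]
        rw [chi_eq_one] at hc
        exact hc
      · rw [if_neg hc, chi_of_not_mem]
        rw [chi_eq_one] at hc
        exact hc

theorem infinite_ge {X : Set ℕ} (h : X.Infinite) (s : ℕ) : (X ∩ {i | s ≤ i}).Infinite := by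
  have : X ∩ {i | s ≤ i} = X \ {i | i < s} := by ext; simp
  rw [this]
  exact h.sdiff (Set.finite_lt_nat s)

structure Cond (n : ℕ) (w : ℕ → ℕ) (Z : Set ℕ) (g : ℕ → Fin (n+1)) where
  F : Fin (n+1) → Finset ℕ
  X : Set ℕ
  hF : ∀ k, ∀ i ∈ F k, g i = k
  hX : X.Infinite
  hG : Good w (zx Z X)

def Cond.Ext {n : ℕ} {w : ℕ → ℕ} {Z : Set ℕ} {g : ℕ → Fin (n+1)} (c' c : Cond n w Z g) : Prop :=
  (∀ k, c.F k ⊆ c'.F k) ∧ (∀ k, ∀ i ∈ c'.F k, i ∈ c.F k ∨ i ∈ c.X) ∧ c'.X ⊆ c.X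

theorem Cond.Ext.refl {n : ℕ} {w : ℕ → ℕ} {Z : Set ℕ} {g : ℕ → Fin (n+1)} (c : Cond n w Z g) :
    Cond.Ext c c := ⟨fun _ => subset_rfl, fun _ _ h => Or.inl h, subset_rfl⟩

theorem Cond.Ext.trans {n : ℕ} {w : ℕ → ℕ} {Z : Set ℕ} {g : ℕ → Fin (n+1)} {c d e : Cond n w Z g}
    (h1 : Cond.Ext c d) (h2 : Cond.Ext d e) : Cond.Ext c e := by
  refine ⟨fun k => (h2.1 k).trans (h1.1 k), fun k i hi => ?_, h1.2.2.trans h2.2.2⟩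
  rcases h1.2.1 k i hi with h | h
  · exact h2.2.1 k i h
  · exact Or.inr (h2.2.2 h)

def Cond.Comp {n : ℕ} {w : ℕ → ℕ} {Z : Set ℕ} {g : ℕ → Fin (n+1)} (c : Cond n w Z g)
    (k : Fin (n+1)) (G : Set ℕ) : Prop :=
  (∀ i ∈ c.F k, i ∈ G) ∧ ∀ i ∈ G, i ∈ c.F k ∨ i ∈ c.X

theorem force_req {n : ℕ} {w : ℕ → ℕ} {Z : Set ℕ} {g : ℕ → Fin (n+1)} (c : Cond n w Z g)
    (Q : Fin (n+1) → List ℕ × ℕ × ℕ → Prop) (hQ : ∀ k, PrimrecPred (Q k)) :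
    ∃ c' : Cond n w Z g, c'.Ext c ∧ ∃ k, ∀ G, c'.Comp k G → Fails w Z G (Q k) := by
  classical
  rcases dichotomy (n := n) c.hG (quest c.F Q) (quest_prim c.F Q hQ) with
    ⟨x, b, hb, H⟩ | ⟨x, H⟩
  · obtain ⟨m, hm⟩ := H g
    rw [quest_iff] at hm
    obtain ⟨k, E, hE, hQE⟩ := hm
    have hEfin : E.Finite := (Set.finite_lt_nat m).subset (fun i hi => (hE i hi).1)
    refine ⟨⟨Function.update c.F k (c.F k ∪ hEfin.toFinset), c.X ∩ {i | m ≤ i}, ?_,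
      infinite_ge c.hX m, good_inter_ge c.hG m⟩, ⟨?_, ?_, Set.inter_subset_left⟩, k, ?_⟩
    · intro j i hi
      by_cases hj : j = k
      · subst hj
        simp at hi
        rcases hi with hi | hi
        · exact c.hF _ i hi
        · exact (hE i hi).2.2
      · simp [hj] at hi
        exact c.hF j i hi
    · intro j
      by_cases hj : j = k
      · subst hj
        simp
      · simp [hj]
    · intro j i hi
      by_cases hj : j = k
      · subst hj
        simp at hi
        rcases hi with hi | hi
        · exact Or.inl hi
        · exact Or.inr (hE i hi).2.1
      · simp [hj] at hi
        exact Or.inl hi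
    · rintro G ⟨hG1, hG2⟩ hcon
      simp only [Function.update_self, Finset.mem_union, Set.Finite.mem_toFinset] at hG1 hG2
      apply hb
      refine ((hcon x b).2 ⟨m, ?_⟩).symm
      convert hQE using 2
      apply pre_congr
      intro i hi
      simp only [zx, tens]
      congr 1
      apply chi_congr
      constructor
      · intro h
        rcases hG2 i h with h | h
        · exact h
        · exact absurd h.2 (by simpa using hi)
      · intro h
        exact hG1 i h
  · obtain ⟨h, hh, hgood⟩ := basis c.hG (fun σ => quest c.F Q (σ, x, w x))
      ((quest_prim c.F Q hQ).comp (Primrec.id.pair (Primrec.const _))) H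
    have : ∃ k, (c.X ∩ h ⁻¹' {k}).Infinite := by
      by_contra hcon
      push Not at hcon
      apply c.hX
      have : c.X = ⋃ k, (c.X ∩ h ⁻¹' {k}) := by ext; simp
      rw [this]
      exact Set.finite_iUnion (fun k => by simpa using hcon k)
    obtain ⟨k, hk⟩ := this
    refine ⟨⟨c.F, c.X ∩ h ⁻¹' {k}, c.hF, hk, good_inter_color k hgood⟩,
      ⟨fun _ => subset_rfl, fun _ _ h => Or.inl h, Set.inter_subset_left⟩, k, ?_⟩
    rintro G ⟨hG1, hG2⟩ hcon
    obtain ⟨m, hm⟩ := (hcon x (w x)).1 rfl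
    apply hh m
    rw [quest_iff]
    refine ⟨k, {i | i < m ∧ i ∈ G ∧ i ∈ c.X ∧ h i = k}, fun i hi => ⟨hi.1, hi.2.2⟩, ?_⟩
    convert hm using 2
    apply pre_congr
    intro i hi
    simp only [zx, tens]
    congr 1
    apply chi_congr
    constructor
    · rintro (h' | h')
      · exact hG1 i h'
      · exact h'.2.1
    · intro h'
      rcases hG2 i h' with h2 | h2
      · exact Or.inl h2
      · exact Or.inr ⟨hi, h', h2.1, h2.2⟩

theorem force_inf {n : ℕ} {w : ℕ → ℕ} {Z : Set ℕ} {g : ℕ → Fin (n+1)} (X0 : Set ℕ)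
    (hdense : ∀ X' ⊆ X0, X'.Infinite → Good w (zx Z X') → ∀ k, ∃ a ∈ X', g a = k)
    (c : Cond n w Z g) (hc : c.X ⊆ X0) (s : ℕ) :
    ∃ c' : Cond n w Z g, c'.Ext c ∧ ∀ k, ∃ a ∈ c'.F k, s ≤ a := by
  classical
  have := hdense (c.X ∩ {i | s ≤ i}) (Set.inter_subset_left.trans hc) (infinite_ge c.hX s)
    (good_inter_ge c.hG s)
  choose a ha hga using this
  refine ⟨⟨fun k => insert (a k) (c.F k), c.X, ?_, c.hX, c.hG⟩, ⟨?_, ?_, subset_rfl⟩, ?_⟩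
  · intro k i hi
    rcases Finset.mem_insert.1 hi with rfl | hi
    · exact hga k
    · exact c.hF k i hi
  · intro k
    exact Finset.subset_insert _ _
  · intro k i hi
    rcases Finset.mem_insert.1 hi with rfl | hi
    · exact Or.inr (ha k).1
    · exact Or.inl hi
  · intro k
    exact ⟨a k, Finset.mem_insert_self _ _, (ha k).2⟩

theorem force_main {n : ℕ} {w : ℕ → ℕ} {Z : Set ℕ} {g : ℕ → Fin (n+1)} (X0 : Set ℕ)
    (hinf : X0.Infinite) (hgood : Good w (zx Z X0))
    (hdense : ∀ X' ⊆ X0, X'.Infinite → Good w (zx Z X') → ∀ k, ∃ a ∈ X', g a = k) :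
    ∃ k, ∃ G : Set ℕ, G.Infinite ∧ (∀ i ∈ G, g i = k ∧ i ∈ X0) ∧ Good w (zx Z G) := by
  classical
  have hcount : Countable (Fin (n+1) → {Q : List ℕ × ℕ × ℕ → Prop | PrimrecPred Q}) := by
    have := (countable_pp (α := List ℕ × ℕ × ℕ)).to_subtype
    infer_instance
  have hne : Nonempty (Fin (n+1) → {Q : List ℕ × ℕ × ℕ → Prop | PrimrecPred Q}) :=
    ⟨fun _ => ⟨_, pp_const True⟩⟩
  obtain ⟨e, he⟩ := exists_surjective_nat
    (Fin (n+1) → {Q : List ℕ × ℕ × ℕ → Prop | PrimrecPred Q})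
  let T := {c : Cond n w Z g // c.X ⊆ X0}
  have step : ∀ (i : ℕ) (c : T), ∃ c' : T, c'.1.Ext c.1 ∧ (∀ k, ∃ a ∈ c'.1.F k, i ≤ a) ∧
      ∃ k, ∀ G, c'.1.Comp k G → Fails w Z G (e i k).1 := by
    rintro i ⟨c, hc⟩
    obtain ⟨c1, h1, h1'⟩ := force_inf X0 hdense c hc i
    obtain ⟨c2, h2, h2'⟩ := force_req c1 (fun k => (e i k).1) (fun k => (e i k).2)
    refine ⟨⟨c2, (h2.2.2.trans h1.2.2).trans hc⟩, h2.trans h1, ?_, h2'⟩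
    intro k
    obtain ⟨a, ha, hia⟩ := h1' k
    exact ⟨a, h2.1 k ha, hia⟩
  choose s hs1 hs2 hs3 using step
  let c0 : T := ⟨⟨fun _ => ∅, X0, by simp, hinf, hgood⟩, subset_rfl⟩
  let D : ℕ → T := fun i => Nat.rec c0 (fun i c => s i c) i
  have hD : ∀ i, D (i+1) = s i (D i) := fun i => rfl
  have hmono : ∀ i j, i ≤ j → (D j).1.Ext (D i).1 := by
    intro i j hij
    induction j, hij using Nat.le_induction with
    | base => exact Cond.Ext.refl _
    | succ j _ ih => rw [hD]; exact (hs1 j _).trans ih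
  let G : Fin (n+1) → Set ℕ := fun k => {a | ∃ i, a ∈ (D i).1.F k}
  have hcomp : ∀ i k, (D i).1.Comp k (G k) := by
    intro i k
    refine ⟨fun a ha => ⟨i, ha⟩, ?_⟩
    rintro a ⟨j, hj⟩
    rcases le_total i j with h | h
    · exact (hmono i j h).2.1 k a hj
    · exact Or.inl ((hmono j i h).1 k hj)
  have hfinal : ∃ k, Good w (zx Z (G k)) := by
    by_contra hcon
    push Not at hcon
    simp only [Good, not_not] at hcon
    choose Q hQ hQR using hcon
    obtain ⟨i, hi⟩ := he (fun k => ⟨Q k, hQ k⟩)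
    obtain ⟨k, hk⟩ := hs3 i (D i)
    have := hk (G k) (hcomp (i+1) k)
    rw [hi] at this
    exact this (hQR k)
  obtain ⟨k, hk⟩ := hfinal
  refine ⟨k, G k, ?_, ?_, hk⟩
  · rw [Set.infinite_iff_exists_gt]
    intro a
    obtain ⟨b, hb, hab⟩ := hs2 (a+1) (D (a+1)) k
    exact ⟨b, ⟨a+1+1, hb⟩, by omega⟩
  · intro a ha
    refine ⟨?_, ?_⟩
    · obtain ⟨i, hi⟩ := ha
      exact (D i).1.hF k a hi
    · rcases (hcomp 0 k).2 a ha with h | h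
      · exact absurd h (Finset.notMem_empty a)
      · exact h

theorem main_induct (w : ℕ → ℕ) (Z : Set ℕ) (n : ℕ) : ∀ (g : ℕ → Fin (n+1)) (X0 : Set ℕ),
    X0.Infinite → Good w (zx Z X0) →
    ∃ k, ∃ G : Set ℕ, G.Infinite ∧ (∀ i ∈ G, g i = k ∧ i ∈ X0) ∧ Good w (zx Z G) := by
  induction n with
  | zero =>
    intro g X0 hinf hgood
    exact ⟨0, X0, hinf, fun i hi => ⟨by omega, hi⟩, hgood⟩
  | succ n ih =>
    intro g X0 hinf hgood
    by_cases hdense : ∀ X' ⊆ X0, X'.Infinite → Good w (zx Z X') → ∀ k, ∃ a ∈ X', g a = k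
    · exact force_main X0 hinf hgood hdense
    · push Not at hdense
      obtain ⟨X', hX', hinf', hgood', k, hk⟩ := hdense
      have : ∀ a, ∃ j : Fin (n+1), a ∈ X' → k.succAbove j = g a := by
        intro a
        by_cases ha : a ∈ X'
        · obtain ⟨j, hj⟩ := Fin.exists_succAbove_eq (hk a ha)
          exact ⟨j, fun _ => hj⟩
        · exact ⟨0, fun h => absurd h ha⟩
      choose g' hg' using this
      obtain ⟨j, G, h1, h2, h3⟩ := ih g' X' hinf' hgood'
      refine ⟨k.succAbove j, G, h1, fun i hi => ?_, h3⟩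
      obtain ⟨h4, h5⟩ := h2 i hi
      exact ⟨by rw [← hg' i h5, h4], hX' h5⟩

/-! ### Normal form for oracle computations -/

theorem pre_le_pre (Y : ℕ → ℕ) {m m' : ℕ} (h : m ≤ m') : pre Y m <+: pre Y m' := by
  obtain ⟨d, rfl⟩ := Nat.exists_eq_add_of_le h
  unfold pre
  rw [List.range_add, List.map_append]
  exact List.prefix_append _ _

def Mono (F : List ℕ × ℕ →. ℕ) : Prop :=
  ∀ σ τ x y, σ <+: τ → y ∈ F (σ, x) → y ∈ F (τ, x)

def Appr (Y : ℕ → ℕ) (f : ℕ →. ℕ) (F : List ℕ × ℕ →. ℕ) : Prop :=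
  ∀ x y, y ∈ f x ↔ ∃ m, y ∈ F (pre Y m, x)

theorem Mono.pre {F : List ℕ × ℕ →. ℕ} (h : Mono F) {Y : ℕ → ℕ} {m m' x y : ℕ} (hm : m ≤ m')
    (hy : y ∈ F (pre Y m, x)) : y ∈ F (RRT.pre Y m', x) :=
  h _ _ _ _ (pre_le_pre Y hm) hy

theorem normal_total (Y : ℕ → ℕ) (f : ℕ → ℕ) (hf : Computable f) :
    ∃ F : List ℕ × ℕ →. ℕ, Partrec F ∧ Mono F ∧ Appr Y (f : ℕ →. ℕ) F := by
  refine ⟨fun p => Part.some (f p.2), (hf.comp Computable.snd).partrec, ?_, ?_⟩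
  · intro σ τ x y _ h
    exact h
  · intro x y
    simp

theorem normal_prec {Y : ℕ → ℕ} {f g : ℕ →. ℕ} {F G : List ℕ × ℕ →. ℕ}
    (hF : Mono F) (hG : Mono G) (hfF : Appr Y f F) (hgG : Appr Y g G) (a n y : ℕ) :
    (y ∈ (Nat.rec (f a) (fun y IH => IH.bind fun i => g (Nat.pair a (Nat.pair y i))) n : Part ℕ)) ↔
    ∃ m, y ∈ (Nat.rec (F (pre Y m, a))
      (fun y IH => IH.bind fun i => G (pre Y m, Nat.pair a (Nat.pair y i))) n : Part ℕ) := by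
  have mono : ∀ n y m m', m ≤ m' → y ∈ (Nat.rec (F (pre Y m, a))
      (fun y IH => IH.bind fun i => G (pre Y m, Nat.pair a (Nat.pair y i))) n : Part ℕ) →
      y ∈ (Nat.rec (F (pre Y m', a))
      (fun y IH => IH.bind fun i => G (pre Y m', Nat.pair a (Nat.pair y i))) n : Part ℕ) := by
    intro n
    induction n with
    | zero => intro y m m' hm h; exact hF.pre hm h
    | succ n ih =>
      intro y m m' hm h
      simp only [Part.mem_bind_iff] at h ⊢
      obtain ⟨i, hi, h2⟩ := h
      exact ⟨i, ih i m m' hm hi, hG.pre hm h2⟩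
  induction n generalizing y with
  | zero => exact hfF a y
  | succ n ih =>
    simp only [Part.mem_bind_iff]
    constructor
    · rintro ⟨i, hi, h2⟩
      obtain ⟨m1, hm1⟩ := (ih i).1 hi
      obtain ⟨m2, hm2⟩ := (hgG _ _).1 h2
      exact ⟨max m1 m2, i, mono n i _ _ (le_max_left _ _) hm1, hG.pre (le_max_right _ _) hm2⟩
    · rintro ⟨m, i, hi, h2⟩
      exact ⟨i, (ih i).2 ⟨m, hi⟩, (hgG _ _).2 ⟨m, h2⟩⟩

theorem mem_rfind_map (H : ℕ → Part ℕ) (y : ℕ) :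
    y ∈ Nat.rfind (fun n => (H n).map (fun m => decide (m = 0))) ↔
    (∃ a, a ∈ H y ∧ decide (a = 0) = true) ∧ ∀ j < y, ∃ c, c ∈ H j ∧ decide (c = 0) = false := by
  refine Nat.mem_rfind.trans ?_
  constructor
  · rintro ⟨h1, h2⟩
    exact ⟨(Part.mem_map_iff _).1 h1, fun j hj => (Part.mem_map_iff _).1 (h2 hj)⟩
  · rintro ⟨h1, h2⟩
    exact ⟨(Part.mem_map_iff _).2 h1, fun {j} hj => (Part.mem_map_iff _).2 (h2 j hj)⟩

theorem rec_of_eq {O f g : ℕ →. ℕ} (hf : RecursiveIn O f) (H : ∀ n, f n = g n) :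
    RecursiveIn O g := (funext H : f = g) ▸ hf

theorem normal_form (Y : ℕ → ℕ) (f : ℕ →. ℕ) (hf : RecursiveIn (Y : ℕ →. ℕ) f) :
    ∃ F : List ℕ × ℕ →. ℕ, Partrec F ∧ Mono F ∧ Appr Y f F := by
  induction hf with
  | zero => exact normal_total Y (fun _ => 0) (Computable.const 0)
  | succ => exact normal_total Y Nat.succ Computable.succ
  | left => exact normal_total Y (fun n => n.unpair.1) (Computable.fst.comp Computable.unpair)
  | right => exact normal_total Y (fun n => n.unpair.2) (Computable.snd.comp Computable.unpair)
  | oracle =>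
    refine ⟨fun p => (p.1[p.2]? : Part ℕ), ?_, ?_, ?_⟩
    · exact Computable.ofOption Primrec.list_getElem?.to_comp
    · rintro σ τ x y ⟨ρ, rfl⟩ h
      simp only [Part.mem_coe, Option.mem_def] at h ⊢
      rw [List.getElem?_append_left]
      · exact h
      · exact (List.getElem?_eq_some_iff.1 h).1
    · intro x y
      simp only [Part.mem_coe, Option.mem_def, pre]
      constructor
      · intro h
        refine ⟨x+1, ?_⟩
        simp at h
        simp [h]
      · rintro ⟨m, h⟩
        rw [List.getElem?_eq_some_iff] at h
        obtain ⟨_, h⟩ := h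
        simp at h
        simp [h]
  | @pair f g _ _ ihf ihg =>
    obtain ⟨F, hF, hFm, hfF⟩ := ihf
    obtain ⟨G, hG, hGm, hgG⟩ := ihg
    refine ⟨fun p => (F p).bind fun a => (G p).map fun b => Nat.pair a b, ?_, ?_, ?_⟩
    · refine Partrec.bind hF ?_
      refine Partrec.map (hG.comp Computable.fst) ?_
      exact Primrec₂.natPair.to_comp.comp (Computable.snd.comp Computable.fst) Computable.snd
    · intro σ τ x y hp h
      simp only [Part.mem_bind_iff, Part.mem_map_iff] at h ⊢
      obtain ⟨a, ha, b, hb, rfl⟩ := h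
      exact ⟨a, hFm _ _ _ _ hp ha, b, hGm _ _ _ _ hp hb, rfl⟩
    · intro x y
      simp only [Seq.seq, Part.map_eq_map, Part.mem_bind_iff, Part.mem_map_iff]
      constructor
      · rintro ⟨_, ⟨a, ha, rfl⟩, b, hb, rfl⟩
        obtain ⟨m1, hm1⟩ := (hfF _ _).1 ha
        obtain ⟨m2, hm2⟩ := (hgG _ _).1 hb
        exact ⟨max m1 m2, a, hFm.pre (le_max_left _ _) hm1, b, hGm.pre (le_max_right _ _) hm2, rfl⟩
      · rintro ⟨m, a, ha, b, hb, rfl⟩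
        exact ⟨_, ⟨a, (hfF _ _).2 ⟨m, ha⟩, rfl⟩, b, (hgG _ _).2 ⟨m, hb⟩, rfl⟩
  | @comp f g _ _ ihf ihg =>
    obtain ⟨F, hF, hFm, hfF⟩ := ihf
    obtain ⟨G, hG, hGm, hgG⟩ := ihg
    refine ⟨fun p => (G p).bind fun b => F (p.1, b), ?_, ?_, ?_⟩
    · refine Partrec.bind hG ?_
      exact hF.comp (Computable.pair (Computable.fst.comp Computable.fst) Computable.snd)
    · intro σ τ x y hp h
      simp only [Part.mem_bind_iff] at h ⊢
      obtain ⟨a, ha, hb⟩ := h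
      exact ⟨a, hGm _ _ _ _ hp ha, hFm _ _ _ _ hp hb⟩
    · intro x y
      change y ∈ (g x).bind f ↔ ∃ m, y ∈ (G (pre Y m, x)).bind fun b => F (pre Y m, b)
      refine Part.mem_bind_iff.trans ?_
      refine Iff.trans ?_ (exists_congr fun m => Part.mem_bind_iff.symm)
      constructor
      · rintro ⟨a, ha, hb⟩
        obtain ⟨m1, hm1⟩ := (hgG _ _).1 ha
        obtain ⟨m2, hm2⟩ := (hfF _ _).1 hb
        exact ⟨max m1 m2, a, hGm.pre (le_max_left _ _) hm1, hFm.pre (le_max_right _ _) hm2⟩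
      · rintro ⟨m, a, ha, hb⟩
        exact ⟨a, (hgG _ _).2 ⟨m, ha⟩, (hfF _ _).2 ⟨m, hb⟩⟩
  | @prec f g _ _ ihf ihg =>
    obtain ⟨F, hF, hFm, hfF⟩ := ihf
    obtain ⟨G, hG, hGm, hgG⟩ := ihg
    refine ⟨fun p => Nat.rec (F (p.1, p.2.unpair.1)) (fun y IH => IH.bind fun i =>
      G (p.1, Nat.pair p.2.unpair.1 (Nat.pair y i))) p.2.unpair.2, ?_, ?_, ?_⟩
    · refine Partrec.nat_rec (f := fun p : List ℕ × ℕ => p.2.unpair.2)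
        (g := fun p => F (p.1, p.2.unpair.1))
        (h := fun p q => G (p.1, Nat.pair p.2.unpair.1 (Nat.pair q.1 q.2))) ?_ ?_ ?_
      · exact Computable.snd.comp (Computable.unpair.comp Computable.snd)
      · exact hF.comp (Computable.pair Computable.fst
          (Computable.fst.comp (Computable.unpair.comp Computable.snd)))
      · refine hG.comp (Computable.pair (Computable.fst.comp Computable.fst) ?_)
        refine Primrec₂.natPair.to_comp.comp
          (Computable.fst.comp (Computable.unpair.comp (Computable.snd.comp Computable.fst))) ?_
        exact Primrec₂.natPair.to_comp.comp (Computable.fst.comp Computable.snd)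
          (Computable.snd.comp Computable.snd)
    · intro σ τ x y hp h
      simp only at h ⊢
      generalize x.unpair.2 = n at h ⊢
      induction n generalizing y with
      | zero => exact hFm _ _ _ _ hp h
      | succ n ih =>
        simp only [Part.mem_bind_iff] at h ⊢
        obtain ⟨i, hi, h2⟩ := h
        exact ⟨i, ih i hi, hGm _ _ _ _ hp h2⟩
    · intro x y
      exact normal_prec hFm hGm hfF hgG x.unpair.1 x.unpair.2 y
  | @rfind f _ ihf =>
    obtain ⟨F, hF, hFm, hfF⟩ := ihf
    refine ⟨fun p => Nat.rfind fun n => (F (p.1, Nat.pair p.2 n)).map (fun m => decide (m = 0)),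
      ?_, ?_, ?_⟩
    · refine Partrec.rfind ?_
      refine Partrec.map (hF.comp (Computable.pair (Computable.fst.comp Computable.fst)
        (Primrec₂.natPair.to_comp.comp (Computable.snd.comp Computable.fst) Computable.snd))) ?_
      have : PrimrecPred (fun m : ℕ => m = 0) := Primrec.eq.comp Primrec.id (Primrec.const 0)
      exact (this.decide.comp Primrec.snd).to_comp
    · intro σ τ x y hp h
      replace h := (mem_rfind_map (fun n => F (σ, Nat.pair x n)) y).1 h
      refine (mem_rfind_map (fun n => F (τ, Nat.pair x n)) y).2 ?_
      obtain ⟨⟨a, ha, ha0⟩, h2⟩ := h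
      refine ⟨⟨a, hFm _ _ _ _ hp ha, ha0⟩, fun j hj => ?_⟩
      obtain ⟨c, hc, hc0⟩ := h2 j hj
      exact ⟨c, hFm _ _ _ _ hp hc, hc0⟩
    · intro x y
      refine (mem_rfind_map (fun n => f (Nat.pair x n)) y).trans ?_
      refine Iff.trans ?_ (exists_congr fun m =>
        (mem_rfind_map (fun n => F (pre Y m, Nat.pair x n)) y).symm)
      constructor
      · rintro ⟨⟨a, ha, ha0⟩, h2⟩
        obtain ⟨m0, hm0⟩ := (hfF _ _).1 ha
        have : ∀ j : ℕ, ∃ m, j < y → ∃ c, c ∈ F (pre Y m, Nat.pair x j) ∧ decide (c = 0) = false := by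
          intro j
          by_cases hj : j < y
          · obtain ⟨c, hc, hc0⟩ := h2 j hj
            obtain ⟨m, hm⟩ := (hfF _ _).1 hc
            exact ⟨m, fun _ => ⟨c, hm, hc0⟩⟩
          · exact ⟨0, fun h => absurd h hj⟩
        choose μ hμ using this
        refine ⟨max m0 ((Finset.range y).sup μ), ⟨a, hFm.pre (le_max_left _ _) hm0, ha0⟩,
          fun j hj => ?_⟩
        obtain ⟨c, hc, hc0⟩ := hμ j hj
        refine ⟨c, hFm.pre (le_trans ?_ (le_max_right _ _)) hc, hc0⟩
        exact Finset.le_sup (f := μ) (by simpa using hj)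
      · rintro ⟨m, ⟨a, ha, ha0⟩, h2⟩
        refine ⟨⟨a, (hfF _ _).2 ⟨m, ha⟩, ha0⟩, fun j hj => ?_⟩
        obtain ⟨c, hc, hc0⟩ := h2 j hj
        exact ⟨c, (hfF _ _).2 ⟨m, hc⟩, hc0⟩

theorem RE_of_recursiveIn (Y w : ℕ → ℕ) (h : RecursiveIn (Y : ℕ →. ℕ) (w : ℕ →. ℕ)) :
    RE Y (fun x b => w x = b) := by
  obtain ⟨F, hF, hFm, hwF⟩ := normal_form Y w h
  obtain ⟨c, hc⟩ := Nat.Partrec.Code.exists_code.1 hF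
  have hc' : ∀ σ x b, b ∈ F (σ, x) ↔ ∃ k, b ∈ c.evaln k (Encodable.encode (σ, x)) := by
    intro σ x b
    rw [← Nat.Partrec.Code.evaln_complete, hc]
    simp
  refine ⟨fun p => c.evaln p.1.length.unpair.2 (Encodable.encode
    (p.1.take p.1.length.unpair.1, p.2.1)) = some p.2.2, ?_, ?_⟩
  · refine Primrec.eq.comp ?_ (Primrec.option_some.comp (Primrec.snd.comp Primrec.snd))
    have hl : Primrec (fun p : List ℕ × ℕ × ℕ => p.1.length.unpair) :=
      Primrec.unpair.comp (Primrec.list_length.comp Primrec.fst)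
    refine Nat.Partrec.Code.primrec_evaln.comp (Primrec.pair (Primrec.pair
      (Primrec.snd.comp hl) (Primrec.const c)) (Primrec.encode.comp (Primrec.pair ?_
        (Primrec.fst.comp Primrec.snd))))
    exact Primrec.list_take.comp (Primrec.fst.comp hl) Primrec.fst
  · intro x b
    have htake : ∀ N m, m ≤ N → (pre Y N).take m = pre Y m := by
      intro N m hm
      have := List.prefix_iff_eq_take.1 (pre_le_pre Y hm)
      rw [pre_length] at this
      exact this.symm
    have h1 : w x = b ↔ ∃ m, b ∈ F (pre Y m, x) := by
      rw [← hwF x b]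
      simp [eq_comm]
    refine h1.trans ?_
    simp only [pre_length]
    constructor
    · rintro ⟨m, hm⟩
      obtain ⟨k, hk⟩ := (hc' _ _ _).1 hm
      refine ⟨Nat.pair m k, ?_⟩
      rw [Nat.unpair_pair, htake _ _ (Nat.left_le_pair m k)]
      exact hk
    · rintro ⟨N, hN⟩
      rw [htake _ _ (Nat.unpair_left_le N)] at hN
      exact ⟨_, (hc' _ _ _).2 ⟨_, hN⟩⟩

theorem recursiveIn_of_partrec (O : ℕ →. ℕ) {f : ℕ →. ℕ} (h : Nat.Partrec f) : RecursiveIn O f := by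
  induction h with
  | zero => exact RecursiveIn.zero
  | succ => exact RecursiveIn.succ
  | left => exact RecursiveIn.left
  | right => exact RecursiveIn.right
  | pair _ _ ih₁ ih₂ => exact RecursiveIn.pair ih₁ ih₂
  | comp _ _ ih₁ ih₂ => exact RecursiveIn.comp ih₁ ih₂
  | prec _ _ ih₁ ih₂ => exact RecursiveIn.prec ih₁ ih₂
  | rfind _ ih => exact RecursiveIn.rfind ih

theorem rec_prim (O : ℕ →. ℕ) {f : ℕ → ℕ} (h : Primrec f) : RecursiveIn O (f : ℕ →. ℕ) :=
  recursiveIn_of_partrec O (Partrec.nat_iff.1 h.to_comp)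

theorem rec_comp {O : ℕ →. ℕ} {f g : ℕ → ℕ} (hf : RecursiveIn O (f : ℕ →. ℕ))
    (hg : RecursiveIn O (g : ℕ →. ℕ)) : RecursiveIn O ((fun n => f (g n) : ℕ → ℕ) : ℕ →. ℕ) := by
  have := RecursiveIn.comp hf hg
  exact rec_of_eq this fun n => Part.bind_some (g n) (f : ℕ →. ℕ)

theorem rec_pair {O : ℕ →. ℕ} {f g : ℕ → ℕ} (hf : RecursiveIn O (f : ℕ →. ℕ))
    (hg : RecursiveIn O (g : ℕ →. ℕ)) :
    RecursiveIn O ((fun n => Nat.pair (f n) (g n) : ℕ → ℕ) : ℕ →. ℕ) := by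
  have := RecursiveIn.pair hf hg
  refine rec_of_eq this fun n => ?_
  simp [Seq.seq]

theorem rec_pre (Y : ℕ → ℕ) :
    RecursiveIn (Y : ℕ →. ℕ) ((fun m => Encodable.encode (pre Y m) : ℕ → ℕ) : ℕ →. ℕ) := by
  let dl : ℕ → List ℕ := fun v => (Encodable.decode (α := List ℕ) v).getD []
  have hdl : Primrec dl := Primrec.option_getD.comp Primrec.decode (Primrec.const [])
  let u : ℕ → ℕ := fun v => Encodable.encode (dl v.unpair.1 ++ [v.unpair.2])
  have hu : Primrec u := Primrec.encode.comp (Primrec.list_concat.comp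
    (hdl.comp (Primrec.fst.comp Primrec.unpair)) (Primrec.snd.comp Primrec.unpair))
  have hl : Primrec (fun n : ℕ => n.unpair.1) := Primrec.fst.comp Primrec.unpair
  have hr : Primrec (fun n : ℕ => n.unpair.2) := Primrec.snd.comp Primrec.unpair
  have hs : RecursiveIn (Y : ℕ →. ℕ)
      ((fun v => u (Nat.pair v.unpair.2.unpair.2 (Y v.unpair.2.unpair.1)) : ℕ → ℕ) : ℕ →. ℕ) :=
    rec_comp (rec_prim _ hu) (rec_pair (rec_prim _ (hr.comp hr))
      (rec_comp RecursiveIn.oracle (rec_prim _ (hl.comp hr))))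
  have h0 : RecursiveIn (Y : ℕ →. ℕ) ((fun _ => Encodable.encode ([] : List ℕ) : ℕ → ℕ) : ℕ →. ℕ) :=
    rec_prim _ (Primrec.const _)
  have h1 := RecursiveIn.comp (RecursiveIn.prec h0 hs)
    (rec_prim (Y : ℕ →. ℕ) (Primrec₂.natPair.comp (Primrec.const 0) Primrec.id))
  refine rec_of_eq h1 fun m => ?_
  simp only [PFun.coe_val, Part.bind_eq_bind, Part.bind_some, Nat.unpaired, Nat.unpair_pair, id]
  induction m with
  | zero => simp [pre]
  | succ m ih =>
    simp only
    rw [ih]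
    simp [u, dl, pre, List.range_succ]

theorem recursiveIn_of_RE (Y w : ℕ → ℕ) (h : RE Y (fun x b => w x = b)) :
    RecursiveIn (Y : ℕ →. ℕ) (w : ℕ →. ℕ) := by
  classical
  obtain ⟨Q, hQ, hQR⟩ := h
  let dl : ℕ → List ℕ := fun v => (Encodable.decode (α := List ℕ) v).getD []
  have hdl : Primrec dl := Primrec.option_getD.comp Primrec.decode (Primrec.const [])
  have hl : Primrec (fun n : ℕ => n.unpair.1) := Primrec.fst.comp Primrec.unpair
  have hr : Primrec (fun n : ℕ => n.unpair.2) := Primrec.snd.comp Primrec.unpair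
  let u : ℕ → ℕ := fun v =>
    if Q (dl v.unpair.1, v.unpair.2.unpair.1, v.unpair.2.unpair.2.unpair.2) then 0 else 1
  have hu : Primrec u := by
    refine Primrec.ite (hQ.comp (Primrec.pair (hdl.comp hl) (Primrec.pair (hl.comp hr) ?_)))
      (Primrec.const 0) (Primrec.const 1)
    exact hr.comp (hr.comp hr)
  have h1 : RecursiveIn (Y : ℕ →. ℕ) ((fun v => u (Nat.pair
      (Encodable.encode (pre Y v.unpair.2.unpair.1)) v) : ℕ → ℕ) : ℕ →. ℕ) :=
    rec_comp (rec_prim _ hu) (rec_pair (rec_comp (rec_pre Y) (rec_prim _ (hl.comp hr)))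
      (rec_prim _ Primrec.id))
  have h2 := RecursiveIn.comp (rec_prim _ hr) (RecursiveIn.rfind h1)
  refine rec_of_eq h2 fun x => ?_
  rw [PFun.coe_val, Part.eq_some_iff]
  have key : ∀ k : ℕ, u (Nat.pair (Encodable.encode (pre Y (Nat.pair x k).unpair.2.unpair.1))
      (Nat.pair x k)) = 0 ↔ Q (pre Y k.unpair.1, x, k.unpair.2) := by
    intro k
    simp [u, dl]
  obtain ⟨m, hm⟩ := (hQR x (w x)).1 rfl
  have hex : ∃ k : ℕ, Q (pre Y k.unpair.1, x, k.unpair.2) := ⟨Nat.pair m (w x), by simpa using hm⟩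
  refine Part.mem_bind_iff.2 ⟨Nat.find hex, ?_, ?_⟩
  · refine (mem_rfind_map (fun n => Part.some (u (Nat.pair (Encodable.encode
      (pre Y (Nat.pair x n).unpair.2.unpair.1)) (Nat.pair x n)))) _).2 ⟨?_, ?_⟩
    · exact ⟨_, Part.mem_some _, decide_eq_true ((key _).2 (Nat.find_spec hex))⟩
    · intro j hj
      exact ⟨_, Part.mem_some _, decide_eq_false ((key j).not.2 (Nat.find_min hex hj))⟩
  · exact Part.mem_some_iff.2 ((hQR x _).2 ⟨_, Nat.find_spec hex⟩)

theorem good_univ {W Z : Set ℕ} (h : ¬ TuringLE W Z) : Good (chi W) (zx Z Set.univ) := by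
  have h0 : Good (chi W) (chi Z) := fun h' => h (recursiveIn_of_RE _ _ h')
  refine Good_map (fun _ y => Nat.pair y 1) ?_ ?_ h0
  · exact Primrec₂.natPair.comp Primrec.snd (Primrec.const 1)
  · intro i
    simp [zx, tens, chi]

theorem not_le_join {W Z X : Set ℕ} (h : Good (chi W) (zx Z X)) : ¬ TuringLE W (join Z X) := by
  intro hle
  have h1 : Good (chi W) (chi (join Z X)) := by
    refine Good_transform (fun i σ => if i % 2 = 0 then (σ.getD (i / 2) 0).unpair.1
      else (σ.getD (i / 2) 0).unpair.2) ?_ ?_ h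
    · have e : Primrec (fun p : ℕ × List ℕ => (p.2.getD (p.1 / 2) 0).unpair) :=
        Primrec.unpair.comp ((Primrec.list_getD 0).comp Primrec.snd
          (Primrec.nat_div.comp Primrec.fst (Primrec.const 2)))
      exact Primrec.ite (Primrec.eq.comp (Primrec.nat_mod.comp Primrec.fst (Primrec.const 2))
        (Primrec.const 0)) (Primrec.fst.comp e) (Primrec.snd.comp e)
    · intro m i hi
      simp only [pre_getD _ m (i / 2) (by omega), zx, tens, Nat.unpair_pair]
      have hj : i ∈ join Z X ↔ (i % 2 = 0 ∧ i / 2 ∈ Z) ∨ (i % 2 ≠ 0 ∧ i / 2 ∈ X) := by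
        constructor
        · rintro (⟨a, ha, rfl⟩ | ⟨a, ha, rfl⟩)
          · left; exact ⟨by omega, by simpa using ha⟩
          · right
            refine ⟨by omega, ?_⟩
            have : (2 * a + 1) / 2 = a := by omega
            rwa [this]
        · rintro (⟨h1, h2⟩ | ⟨h1, h2⟩)
          · exact Or.inl ⟨_, h2, by omega⟩
          · exact Or.inr ⟨_, h2, by omega⟩
      by_cases h2 : i % 2 = 0
      · rw [if_pos h2]
        by_cases h3 : i / 2 ∈ Z
        · rw [chi_of_mem h3, chi_of_mem (hj.2 (Or.inl ⟨h2, h3⟩))]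
        · rw [chi_of_not_mem h3, chi_of_not_mem (fun h => by have := hj.1 h; tauto)]
      · rw [if_neg h2]
        by_cases h3 : i / 2 ∈ X
        · rw [chi_of_mem h3, chi_of_mem (hj.2 (Or.inr ⟨h2, h3⟩))]
        · rw [chi_of_not_mem h3, chi_of_not_mem (fun h => by have := hj.1 h; tauto)]
  exact h1 (RE_of_recursiveIn _ _ hle)

/-- Seetapun's cone avoidance for the infinite pigeonhole principle:
if `W ≰_T Z` and `g : ℕ → Fin n` is an arbitrary finite partition of ℕ (no computability
hypothesis on `g`), then there are `k < n` and an infinite `X ⊆ g⁻¹(k)` with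
`W ≰_T Z ⊕ X`. -/
theorem statement1 (W Z : Set ℕ) (hWZ : ¬ TuringLE W Z) (n : ℕ) (g : ℕ → Fin n) :
    ∃ k : Fin n, ∃ X : Set ℕ, X.Infinite ∧ X ⊆ g ⁻¹' {k} ∧ ¬ TuringLE W (join Z X) := by
  cases n with
  | zero => exact (g 0).elim0
  | succ n =>
    obtain ⟨k, G, h1, h2, h3⟩ := main_induct (chi W) Z n g Set.univ Set.infinite_univ
      (good_univ hWZ)
    exact ⟨k, G, h1, fun i hi => (h2 i hi).1, not_le_join h3⟩

end RRT
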